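/- arXiv:2102.04061 — 2 statements merged into one kernel-verified Lean document; each statement's English description precedes it below -/
import Mathlib

section
/- Let b : ℝ^d → ℝ^d and σ : ℝ^d → ℝ^{d×d} be globally Lipschitz with constant L and satisfy |b(0)| + |σ(0)| ≤ L, and suppose σ(x) is invertible for every x ∈ ℝ^d. Fix θ ∈ [0,1] and T > 0. Define I(x) = inf{ A(φ) : φ ∈ H¹_{x₀}(0,T;ℝ^d), φ(T) = x } with A(φ) = (1/2)∫₀^T |σ(φ(t))^{-1}(φ'(t) − b(φ(t)))|² dt, and I^h(x) = inf{ B_h(φ) : φ ∈ H¹_{x₀}(0,T;ℝ^d), φ(T) = x } with B_h(φ) = (1/2)∫₀^T |σ(φ(t̂))^{-1}(φ'(t) − b((1−θ)φ(t̂) + θφ(ť)))|² dt. Then for every R > 0 there exists a constant K₁(R) > 0 such that for all h = T/N with h ∈ (0, min(1/(2L),1)], sup_{|x| ≤ R} |I^h(x) − I(x)| ≤ K₁(R) h^{1/2}. -/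
open MeasureTheory Set

/-- Largest grid point `t_n = n h` below `t`. -/
noncomputable def gridHat (h t : ℝ) : ℝ := h * ⌊t / h⌋

/-- Smallest grid point `t_n = n h` above `t`. -/
noncomputable def gridCheck (h t : ℝ) : ℝ := h * ⌈t / h⌉

/-- Values `A(φ)` over `φ ∈ H¹_{x₀}(0,T;ℝ^d)` with `φ(T) = x`; `I(x)` is their infimum. -/
def rateValues (d : ℕ) (T : ℝ) (x₀ : EuclideanSpace ℝ (Fin d))
    (b : EuclideanSpace ℝ (Fin d) → EuclideanSpace ℝ (Fin d))
    (σ : EuclideanSpace ℝ (Fin d) →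
      (EuclideanSpace ℝ (Fin d) →L[ℝ] EuclideanSpace ℝ (Fin d)))
    (x : EuclideanSpace ℝ (Fin d)) : Set ℝ :=
  {r : ℝ | ∃ φ φ' : ℝ → EuclideanSpace ℝ (Fin d),
    IntegrableOn φ' (Icc 0 T) ∧
    IntegrableOn (fun t => ‖φ' t‖ ^ 2) (Icc 0 T) ∧
    (∀ t ∈ Icc (0 : ℝ) T, φ t = x₀ + ∫ s in (0 : ℝ)..t, φ' s) ∧
    φ T = x ∧
    r = (1 / 2) * ∫ t in (0 : ℝ)..T,
      ‖(Ring.inverse (σ (φ t))) (φ' t - b (φ t))‖ ^ 2}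

/-- Values `B_h(φ)` of the θ-method functional over `φ ∈ H¹_{x₀}` with `φ(T) = x`;
`I^h(x)` is their infimum (`h = T/N`). -/
noncomputable def rateValuesH (d : ℕ) (T : ℝ) (x₀ : EuclideanSpace ℝ (Fin d)) (θ : ℝ)
    (b : EuclideanSpace ℝ (Fin d) → EuclideanSpace ℝ (Fin d))
    (σ : EuclideanSpace ℝ (Fin d) →
      (EuclideanSpace ℝ (Fin d) →L[ℝ] EuclideanSpace ℝ (Fin d)))
    (h : ℝ) (x : EuclideanSpace ℝ (Fin d)) : Set ℝ :=
  {r : ℝ | ∃ φ φ' : ℝ → EuclideanSpace ℝ (Fin d),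
    IntegrableOn φ' (Icc 0 T) ∧
    IntegrableOn (fun t => ‖φ' t‖ ^ 2) (Icc 0 T) ∧
    (∀ t ∈ Icc (0 : ℝ) T, φ t = x₀ + ∫ s in (0 : ℝ)..t, φ' s) ∧
    φ T = x ∧
    r = (1 / 2) * ∫ t in (0 : ℝ)..T,
      ‖(Ring.inverse (σ (φ (gridHat h t))))
        (φ' t - b ((1 - θ) • φ (gridHat h t) + θ • φ (gridCheck h t)))‖ ^ 2}

section Helpers

variable {E : Type*} [NormedAddCommGroup E] [NormedSpace ℝ E]

/-- The integrand `|σ(p)⁻¹ (z - b(q))|²` of both action functionals. -/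
noncomputable def lagrangian (b : E → E) (σ : E → (E →L[ℝ] E)) (p q z : E) : ℝ :=
  ‖(Ring.inverse (σ p)) (z - b q)‖ ^ 2

/-- `φ` is an `H¹` path on `[0, T]` from `x₀` to `x` with derivative `φ'`,
extended continuously to the whole line. -/
structure IsSobolevPath (T : ℝ) (x₀ x : E) (φ φ' : ℝ → E) : Prop where
  cont : Continuous φ
  int : IntegrableOn φ' (Icc 0 T)
  sq_int : IntegrableOn (fun t => ‖φ' t‖ ^ 2) (Icc 0 T)
  eq_integral : ∀ t ∈ Icc (0 : ℝ) T, φ t = x₀ + ∫ s in (0 : ℝ)..t, φ' s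
  endpoint : φ T = x

lemma IsSobolevPath.intervalIntegrable {T : ℝ} {x₀ x : E} {φ φ' : ℝ → E}
    (hφ : IsSobolevPath T x₀ x φ φ') {s t : ℝ} (hs : s ∈ Icc 0 T) (ht : t ∈ Icc 0 T) :
    IntervalIntegrable φ' volume s t :=
  (hφ.int.mono_set (uIcc_subset_Icc hs ht)).intervalIntegrable

lemma IsSobolevPath.intervalIntegrable_sq {T : ℝ} {x₀ x : E} {φ φ' : ℝ → E}
    (hφ : IsSobolevPath T x₀ x φ φ') {s t : ℝ} (hs : s ∈ Icc 0 T) (ht : t ∈ Icc 0 T) :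
    IntervalIntegrable (fun t => ‖φ' t‖ ^ 2) volume s t :=
  (hφ.sq_int.mono_set (uIcc_subset_Icc hs ht)).intervalIntegrable

/-- Every `H¹` path on `[0, T]` agrees there with a globally continuous one. -/
lemma exists_isSobolevPath_eqOn {T : ℝ} (hT : 0 < T) {x₀ x : E} {φ φ' : ℝ → E}
    (h1 : IntegrableOn φ' (Icc 0 T)) (h2 : IntegrableOn (fun t => ‖φ' t‖ ^ 2) (Icc 0 T))
    (h3 : ∀ t ∈ Icc (0 : ℝ) T, φ t = x₀ + ∫ s in (0 : ℝ)..t, φ' s) (h4 : φ T = x) :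
    ∃ ψ : ℝ → E, IsSobolevPath T x₀ x ψ φ' ∧ ∀ t ∈ Icc (0 : ℝ) T, φ t = ψ t := by
  have hc : ContinuousOn φ (Icc 0 T) := by
    have : ContinuousOn (fun t => x₀ + ∫ s in (0 : ℝ)..t, φ' s) (Icc 0 T) :=
      continuousOn_const.add (intervalIntegral.continuousOn_primitive_interval
        (by rwa [uIcc_of_le hT.le]))|>.mono (by rw [uIcc_of_le hT.le])
    exact this.congr h3
  have heq : ∀ t ∈ Icc (0 : ℝ) T, φ t = IccExtend hT.le (fun s : Icc 0 T => φ s) t := by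
    intro t ht
    rw [IccExtend_of_mem _ _ ht]
  refine ⟨IccExtend hT.le (fun s : Icc 0 T => φ s), ⟨?_, h1, h2, ?_, ?_⟩, heq⟩
  · exact (continuousOn_iff_continuous_domRestrict.1 hc).Icc_extend'
  · intro t ht
    rw [← heq t ht, h3 t ht]
  · rw [← heq T ⟨hT.le, le_rfl⟩, h4]

lemma IsSobolevPath.sub_eq_integral {T : ℝ} {x₀ x : E} {φ φ' : ℝ → E}
    (hφ : IsSobolevPath T x₀ x φ φ') {s t : ℝ} (hs : s ∈ Icc 0 T) (ht : t ∈ Icc 0 T) :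
    φ t - φ s = ∫ r in s..t, φ' r := by
  have h0 : (0 : ℝ) ∈ Icc 0 T := ⟨le_rfl, hs.1.trans hs.2⟩
  rw [hφ.eq_integral t ht, hφ.eq_integral s hs, add_sub_add_left_eq_sub,
    intervalIntegral.integral_interval_sub_left (hφ.intervalIntegrable h0 ht)
      (hφ.intervalIntegrable h0 hs)]

/-- Hölder-type modulus of continuity of an `H¹` path. -/
lemma IsSobolevPath.norm_sub_le {T : ℝ} {x₀ x : E} {φ φ' : ℝ → E}
    (hφ : IsSobolevPath T x₀ x φ φ') {C h : ℝ} (hh : 0 < h)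
    (hC : ∫ t in (0 : ℝ)..T, ‖φ' t‖ ^ 2 ≤ C) {s t : ℝ} (hs : s ∈ Icc 0 T) (ht : t ∈ Icc 0 T)
    (hst : s ≤ t) (hts : t ≤ s + h) : ‖φ t - φ s‖ ≤ (1 + C) * √h := by
  have hq : 0 < √h := Real.sqrt_pos.2 hh
  have hqq : √h * √h = h := Real.mul_self_sqrt hh.le
  have hi := hφ.intervalIntegrable hs ht
  have hi2 := hφ.intervalIntegrable_sq hs ht
  have hsub : ∫ r in s..t, ‖φ' r‖ ^ 2 ≤ C := by
    refine le_trans ?_ hC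
    refine intervalIntegral.integral_mono_interval hs.1 hst ht.2
      (Filter.Eventually.of_forall fun r => by positivity) ?_
    exact hφ.intervalIntegrable_sq ⟨le_rfl, hs.1.trans hs.2⟩ ⟨hs.1.trans hs.2, le_rfl⟩
  have hC0 : 0 ≤ C := le_trans (intervalIntegral.integral_nonneg hst fun r _ => by positivity) hsub
  rw [hφ.sub_eq_integral hs ht]
  calc ‖∫ r in s..t, φ' r‖ ≤ ∫ r in s..t, ‖φ' r‖ :=
        intervalIntegral.norm_integral_le_integral_norm hst
    _ ≤ ∫ r in s..t, (√h * ‖φ' r‖ ^ 2 + 1 / √h) := by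
        refine intervalIntegral.integral_mono_on hst hi.norm
          ((hi2.const_mul _).add intervalIntegrable_const) fun r _ => ?_
        have : √h * ‖φ' r‖ ^ 2 + 1 / √h - ‖φ' r‖
            = ((√h * ‖φ' r‖ - 1 / 2) ^ 2 + 3 / 4) / √h := by
          field_simp
          ring
        have h' : 0 ≤ ((√h * ‖φ' r‖ - 1 / 2) ^ 2 + 3 / 4) / √h := by positivity
        linarith
    _ = √h * (∫ r in s..t, ‖φ' r‖ ^ 2) + (t - s) / √h := by
        rw [intervalIntegral.integral_add (hi2.const_mul _) intervalIntegrable_const,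
          intervalIntegral.integral_const_mul, intervalIntegral.integral_const, smul_eq_mul]
        ring
    _ ≤ √h * C + √h := by
        gcongr
        rw [div_le_iff₀ hq, hqq]
        linarith
    _ = (1 + C) * √h := by ring

lemma integral_exp_backward_le {l : ℝ} (hl : 0 < l) (t : ℝ) :
    ∫ s in (0 : ℝ)..t, Real.exp (-(2 * l * (t - s))) ≤ 1 / (2 * l) := by
  have hd : ∀ s ∈ uIcc 0 t, HasDerivAt (fun s => Real.exp (-(2 * l * (t - s))) / (2 * l))
      (Real.exp (-(2 * l * (t - s)))) s := by
    intro s _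
    have h1 : HasDerivAt (fun s => -(2 * l * (t - s))) (2 * l) s := by
      simpa using (((hasDerivAt_id s).const_sub t).const_mul (2 * l)).fun_neg
    have := h1.exp.div_const (2 * l)
    rwa [mul_div_cancel_right₀ _ (by positivity : 2 * l ≠ 0)] at this
  rw [intervalIntegral.integral_eq_sub_of_hasDerivAt hd
    (Continuous.intervalIntegrable (by fun_prop) _ _)]
  have : 0 ≤ Real.exp (-(2 * l * (t - 0))) / (2 * l) := by positivity
  simp only [sub_self, mul_zero, neg_zero, Real.exp_zero]
  linarith

/-- A Gronwall bound with square-integrable control `v` and a look-ahead of length `h`. -/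
lemma IsSobolevPath.norm_le_of_control {T : ℝ} (hT : 0 < T) {x₀ x : E} {φ φ' : ℝ → E}
    (hφ : IsSobolevPath T x₀ x φ φ') {L V h : ℝ} (hL : 0 < L) (hV : 0 < V)
    (hh : 18 * L ^ 2 * V * h ≤ 1) {v : ℝ → ℝ}
    (hv : IntegrableOn (fun s => (1 + v s) ^ 2) (Icc 0 T))
    (hvV : ∫ s in (0 : ℝ)..T, (1 + v s) ^ 2 ≤ V)
    (hctrl : ∀ s ∈ Icc 0 T, ∀ C : ℝ, (∀ r ∈ Icc 0 T, r ≤ s + h → 1 + ‖φ r‖ ≤ C) →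
      ‖φ' s‖ ≤ L * C * (1 + v s)) :
    ∀ t ∈ Icc 0 T, 1 + ‖φ t‖ ≤ 2 * (1 + ‖x₀‖) * Real.exp (18 * L ^ 2 * V * T) := by
  set l := 18 * L ^ 2 * V with hl
  have hl0 : 0 < l := by positivity
  have hFc : Continuous fun t => Real.exp (-(l * t)) * (1 + ‖φ t‖) := by
    have := hφ.cont
    fun_prop
  obtain ⟨m, hm, hmax⟩ := isCompact_Icc.exists_isMaxOn (nonempty_Icc.2 hT.le) hFc.continuousOn
  set S := Real.exp (-(l * m)) * (1 + ‖φ m‖) with hS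
  have hS0 : 0 < S := by positivity
  have hle : ∀ r ∈ Icc 0 T, 1 + ‖φ r‖ ≤ S * Real.exp (l * r) := by
    intro r hr
    have h1 : Real.exp (-(l * r)) * (1 + ‖φ r‖) ≤ S := hmax hr
    calc 1 + ‖φ r‖ = (Real.exp (-(l * r)) * (1 + ‖φ r‖)) * Real.exp (l * r) := by
          rw [mul_right_comm, ← Real.exp_add]; simp
      _ ≤ _ := by gcongr
  have hexp3 : Real.exp (l * h) ≤ 3 :=
    (Real.exp_le_exp.2 hh).trans (Real.exp_one_lt_d9.le.trans (by norm_num))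
  have h0 : (0 : ℝ) ∈ Icc 0 T := ⟨le_rfl, hT.le⟩
  have hderiv : ∀ s ∈ Icc 0 T, ‖φ' s‖ ≤ 3 * L * S * Real.exp (l * s) * (1 + v s) := by
    intro s hs
    have h1 := hctrl s hs (S * (3 * Real.exp (l * s))) fun r hr hrs => by
      refine (hle r hr).trans ?_
      gcongr
      calc Real.exp (l * r) ≤ Real.exp (l * h + l * s) := by
            apply Real.exp_le_exp.2
            nlinarith
        _ = Real.exp (l * h) * Real.exp (l * s) := Real.exp_add _ _
        _ ≤ _ := by gcongr
    linarith
  set ε := 1 / (6 * L * V) with hε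
  have hε0 : 0 < ε := by positivity
  have hm2 : ‖φ m‖ ≤ ‖x₀‖ + Real.exp (l * m) * (S / 2) := by
    have hi1 := hφ.intervalIntegrable h0 hm
    have hv1 : IntervalIntegrable (fun s => (1 + v s) ^ 2) volume 0 m :=
      (hv.mono_set (uIcc_subset_Icc h0 hm)).intervalIntegrable
    have he1 : IntervalIntegrable (fun s => Real.exp (-(2 * l * (m - s)))) volume 0 m :=
      Continuous.intervalIntegrable (by fun_prop) _ _
    have hvm : ∫ s in (0 : ℝ)..m, (1 + v s) ^ 2 ≤ V := by
      refine le_trans ?_ hvV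
      refine intervalIntegral.integral_mono_interval le_rfl hm.1 hm.2
        (Filter.Eventually.of_forall fun r => by positivity) ?_
      exact (hv.mono_set (uIcc_subset_Icc h0 ⟨hT.le, le_rfl⟩)).intervalIntegrable
    have hbig : ‖∫ s in (0 : ℝ)..m, φ' s‖ ≤ Real.exp (l * m) * (S / 2) := by
      calc ‖∫ s in (0 : ℝ)..m, φ' s‖ ≤ ∫ s in (0 : ℝ)..m, ‖φ' s‖ :=
            intervalIntegral.norm_integral_le_integral_norm hm.1
        _ ≤ ∫ s in (0 : ℝ)..m, 3 * L * S * Real.exp (l * m) *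
              (ε / 2 * (1 + v s) ^ 2 + 1 / (2 * ε) * Real.exp (-(2 * l * (m - s)))) := by
            refine intervalIntegral.integral_mono_on hm.1 hi1.norm
              (((hv1.const_mul _).add (he1.const_mul _)).const_mul _) fun s hs => ?_
            refine (hderiv s ⟨hs.1, hs.2.trans hm.2⟩).trans ?_
            have e1 : Real.exp (l * s) = Real.exp (l * m) * Real.exp (-(l * (m - s))) := by
              rw [← Real.exp_add]; ring_nf
            have e2 : Real.exp (-(2 * l * (m - s))) = Real.exp (-(l * (m - s))) ^ 2 := by
              rw [sq, ← Real.exp_add]; ring_nf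
            rw [e1, e2]
            set a := Real.exp (-(l * (m - s)))
            have key : a * (1 + v s) ≤ ε / 2 * (1 + v s) ^ 2 + 1 / (2 * ε) * a ^ 2 := by
              have : ε / 2 * (1 + v s) ^ 2 + 1 / (2 * ε) * a ^ 2 - a * (1 + v s)
                  = (ε * (1 + v s) - a) ^ 2 / (2 * ε) := by
                field_simp
                ring
              have h' : 0 ≤ (ε * (1 + v s) - a) ^ 2 / (2 * ε) := by positivity
              linarith
            calc 3 * L * S * (Real.exp (l * m) * a) * (1 + v s)
                = 3 * L * S * Real.exp (l * m) * (a * (1 + v s)) := by ring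
              _ ≤ _ := by gcongr
        _ = 3 * L * S * Real.exp (l * m) * (ε / 2 * (∫ s in (0 : ℝ)..m, (1 + v s) ^ 2) +
              1 / (2 * ε) * ∫ s in (0 : ℝ)..m, Real.exp (-(2 * l * (m - s)))) := by
            rw [intervalIntegral.integral_const_mul,
              intervalIntegral.integral_add (hv1.const_mul _) (he1.const_mul _),
              intervalIntegral.integral_const_mul, intervalIntegral.integral_const_mul]
        _ ≤ 3 * L * S * Real.exp (l * m) * (ε / 2 * V + 1 / (2 * ε) * (1 / (2 * l))) := by
            gcongr
            exact integral_exp_backward_le hl0 m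
        _ = Real.exp (l * m) * (S / 2) := by
            rw [hε, hl]
            field_simp
            norm_num
    rw [hφ.eq_integral m hm]
    exact (norm_add_le _ _).trans (by gcongr)
  have hS2 : S ≤ 2 * (1 + ‖x₀‖) := by
    have e0 : Real.exp (-(l * m)) * Real.exp (l * m) = 1 := by rw [← Real.exp_add]; simp
    have e1 : Real.exp (-(l * m)) ≤ 1 := by
      apply Real.exp_le_one_iff.2
      have := mul_nonneg hl0.le hm.1
      linarith
    have : S ≤ Real.exp (-(l * m)) * (1 + ‖x₀‖) + S / 2 := by
      calc S ≤ Real.exp (-(l * m)) * (1 + (‖x₀‖ + Real.exp (l * m) * (S / 2))) := by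
            rw [hS]; gcongr
        _ = Real.exp (-(l * m)) * (1 + ‖x₀‖)
            + (Real.exp (-(l * m)) * Real.exp (l * m)) * (S / 2) := by ring
        _ = _ := by rw [e0, one_mul]
    have h3 : Real.exp (-(l * m)) * (1 + ‖x₀‖) ≤ 1 * (1 + ‖x₀‖) := by gcongr
    linarith
  intro t ht
  refine (hle t ht).trans ?_
  gcongr
  exact ht.2

lemma norm_le_of_lipschitz {X F : Type*} [NormedAddCommGroup X] [NormedAddCommGroup F]
    {L : NNReal} {f : X → F}
    (hf : LipschitzWith L f) (h0 : ‖f 0‖ ≤ L) (y : X) : ‖f y‖ ≤ L * (1 + ‖y‖) := by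
  have h1 := hf.norm_sub_le y 0
  have h2 := norm_le_norm_add_norm_sub (f 0) (f y)
  rw [norm_sub_rev, sub_zero] at *
  rw [norm_sub_rev] at h2
  linarith

lemma continuous_inverse_comp [CompleteSpace E] {L : NNReal} {σ : E → (E →L[ℝ] E)}
    (hσ : LipschitzWith L σ) (hinv : ∀ x, IsUnit (σ x)) :
    Continuous fun p => Ring.inverse (σ p) :=
  continuous_iff_continuousAt.2 fun p => by
    obtain ⟨u, hu⟩ := hinv p
    exact ContinuousAt.comp (g := Ring.inverse)
      (by rw [← hu]; exact NormedRing.inverse_continuousAt u) hσ.continuous.continuousAt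

/-- Bounds for the inverse diffusion coefficient on a ball. -/
lemma exists_norm_inverse_le [ProperSpace E] {L : NNReal}
    {σ : E → (E →L[ℝ] E)} (hσ : LipschitzWith L σ) (hinv : ∀ x, IsUnit (σ x)) (C : ℝ) :
    ∃ Q : ℝ, 0 ≤ Q ∧ ∀ p : E, ‖p‖ ≤ C → ‖Ring.inverse (σ p)‖ ≤ Q := by
  obtain ⟨Q, hQ⟩ := (isCompact_closedBall (0 : E) C).exists_bound_of_continuousOn
    (continuous_inverse_comp hσ hinv).continuousOn
  exact ⟨max Q 0, le_max_right _ _, fun p hp =>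
    (hQ p (by simpa using hp)).trans (le_max_left _ _)⟩

/-- Quadratic growth in the velocity and local Lipschitz dependence on the frozen state. -/
lemma exists_lagrangian_bounds [ProperSpace E] {L : NNReal}
    {b : E → E} {σ : E → (E →L[ℝ] E)} (hb : LipschitzWith L b) (hσ : LipschitzWith L σ)
    (hb0 : ‖b 0‖ ≤ L) (hinv : ∀ x, IsUnit (σ x)) {C : ℝ} (hC : 0 ≤ C) :
    ∃ D : ℝ, 0 ≤ D ∧
      (∀ p q z : E, ‖p‖ ≤ C → ‖q‖ ≤ C → lagrangian b σ p q z ≤ D * (1 + ‖z‖ ^ 2)) ∧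
      ∀ p q p₁ q₁ z : E, ∀ η : ℝ, ‖p‖ ≤ C → ‖q‖ ≤ C → ‖p₁‖ ≤ C → ‖q₁‖ ≤ C →
        ‖p - p₁‖ ≤ η → ‖q - q₁‖ ≤ η →
        |lagrangian b σ p q z - lagrangian b σ p₁ q₁ z| ≤ D * η * (1 + ‖z‖ ^ 2) := by
  obtain ⟨Q, hQ0, hQ⟩ := exists_norm_inverse_le hσ hinv C
  set G : ℝ := 1 + L * (1 + C) with hG
  have hG1 : 1 ≤ G := by
    have : 0 ≤ (L : ℝ) * (1 + C) := by positivity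
    linarith
  have hbC : ∀ q : E, ‖q‖ ≤ C → ‖b q‖ ≤ L * (1 + C) := fun q hq =>
    (norm_le_of_lipschitz hb hb0 q).trans (by gcongr)
  have hzb : ∀ q z : E, ‖q‖ ≤ C → ‖z - b q‖ ≤ G * (1 + ‖z‖) := by
    intro q z hq
    have h1 := norm_sub_le z (b q)
    have h2 := hbC q hq
    have h3 : 0 ≤ (G - 1) * ‖z‖ := mul_nonneg (by linarith) (norm_nonneg z)
    nlinarith
  have hw : ∀ p q z : E, ‖p‖ ≤ C → ‖q‖ ≤ C →
      ‖(Ring.inverse (σ p)) (z - b q)‖ ≤ Q * G * (1 + ‖z‖) := by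
    intro p q z hp hq
    calc _ ≤ ‖Ring.inverse (σ p)‖ * ‖z - b q‖ := ContinuousLinearMap.le_opNorm _ _
      _ ≤ Q * (G * (1 + ‖z‖)) := mul_le_mul (hQ p hp) (hzb q z hq) (norm_nonneg _) hQ0
      _ = _ := by ring
  have hsq : ∀ z : E, (1 + ‖z‖) ^ 2 ≤ 2 * (1 + ‖z‖ ^ 2) := fun z => by
    nlinarith [sq_nonneg (1 - ‖z‖)]
  refine ⟨2 * (Q * G) ^ 2 + 4 * (Q * G) * (Q * L * Q * G + Q * L), by positivity, ?_, ?_⟩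
  · intro p q z hp hq
    calc lagrangian b σ p q z ≤ (Q * G * (1 + ‖z‖)) ^ 2 :=
          pow_le_pow_left₀ (norm_nonneg _) (hw p q z hp hq) 2
      _ = (Q * G) ^ 2 * (1 + ‖z‖) ^ 2 := by ring
      _ ≤ (Q * G) ^ 2 * (2 * (1 + ‖z‖ ^ 2)) := by gcongr; exact hsq z
      _ = 2 * (Q * G) ^ 2 * (1 + ‖z‖ ^ 2) := by ring
      _ ≤ _ := by
          gcongr
          have : 0 ≤ 4 * (Q * G) * (Q * L * Q * G + Q * L) := by positivity
          linarith
  · intro p q p₁ q₁ z η hp hq hp₁ hq₁ hpη hqη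
    have hη : 0 ≤ η := (norm_nonneg _).trans hpη
    have hres : Ring.inverse (σ p) - Ring.inverse (σ p₁)
        = Ring.inverse (σ p) * (σ p₁ - σ p) * Ring.inverse (σ p₁) := by
      rw [mul_sub, sub_mul, Ring.inverse_mul_cancel _ (hinv p), one_mul, mul_assoc,
        Ring.mul_inverse_cancel _ (hinv p₁), mul_one]
    have hdinv : ‖Ring.inverse (σ p) - Ring.inverse (σ p₁)‖ ≤ Q * (L * η) * Q := by
      rw [hres]
      have h1 : ‖σ p₁ - σ p‖ ≤ L * η := by
        rw [norm_sub_rev]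
        exact (hσ.norm_sub_le p p₁).trans (by gcongr)
      calc _ ≤ ‖Ring.inverse (σ p) * (σ p₁ - σ p)‖ * ‖Ring.inverse (σ p₁)‖ := norm_mul_le _ _
        _ ≤ ‖Ring.inverse (σ p)‖ * ‖σ p₁ - σ p‖ * ‖Ring.inverse (σ p₁)‖ := by
            gcongr; exact norm_mul_le _ _
        _ ≤ _ := by
            gcongr
            exacts [hQ p hp, hQ p₁ hp₁]
    set w := (Ring.inverse (σ p)) (z - b q) with hwdef
    set w₁ := (Ring.inverse (σ p₁)) (z - b q₁) with hw₁def
    have hdiff : ‖w - w₁‖ ≤ (Q * L * Q * G + Q * L) * η * (1 + ‖z‖) := by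
      have e : w - w₁ = (Ring.inverse (σ p) - Ring.inverse (σ p₁)) (z - b q)
          + (Ring.inverse (σ p₁)) (b q₁ - b q) := by
        rw [hwdef, hw₁def, _root_.sub_apply, map_sub, map_sub, map_sub, map_sub]
        abel
      have h1 : ‖b q₁ - b q‖ ≤ L * η := by
        rw [norm_sub_rev]
        exact (hb.norm_sub_le q q₁).trans (by gcongr)
      rw [e]
      calc _ ≤ ‖Ring.inverse (σ p) - Ring.inverse (σ p₁)‖ * ‖z - b q‖
            + ‖Ring.inverse (σ p₁)‖ * ‖b q₁ - b q‖ :=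
            (norm_add_le _ _).trans (add_le_add (ContinuousLinearMap.le_opNorm _ _)
              (ContinuousLinearMap.le_opNorm _ _))
        _ ≤ Q * (L * η) * Q * (G * (1 + ‖z‖)) + Q * (L * η) := by
            gcongr
            exacts [hzb q z hq, hQ p₁ hp₁]
        _ ≤ Q * (L * η) * Q * (G * (1 + ‖z‖)) + Q * (L * η) * (1 + ‖z‖) := by
            have h1z : 1 ≤ 1 + ‖z‖ := by linarith [norm_nonneg z]
            exact add_le_add le_rfl (le_mul_of_one_le_right (by positivity) h1z)
        _ = _ := by ring
    have hsum : ‖w‖ + ‖w₁‖ ≤ 2 * (Q * G) * (1 + ‖z‖) := by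
      linarith [hw p q z hp hq, hw p₁ q₁ z hp₁ hq₁]
    have hfac : lagrangian b σ p q z - lagrangian b σ p₁ q₁ z
        = (‖w‖ - ‖w₁‖) * (‖w‖ + ‖w₁‖) := by
      simp only [lagrangian, ← hwdef, ← hw₁def]
      ring
    rw [hfac, abs_mul, abs_of_nonneg (add_nonneg (norm_nonneg w) (norm_nonneg w₁))]
    calc |‖w‖ - ‖w₁‖| * (‖w‖ + ‖w₁‖)
        ≤ ((Q * L * Q * G + Q * L) * η * (1 + ‖z‖)) * (2 * (Q * G) * (1 + ‖z‖)) :=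
          mul_le_mul ((abs_norm_sub_norm_le w w₁).trans hdiff) hsum (by positivity)
            (by positivity)
      _ = 2 * (Q * G) * (Q * L * Q * G + Q * L) * η * (1 + ‖z‖) ^ 2 := by ring
      _ ≤ 2 * (Q * G) * (Q * L * Q * G + Q * L) * η * (2 * (1 + ‖z‖ ^ 2)) := by
          gcongr; exact hsq z
      _ = 4 * (Q * G) * (Q * L * Q * G + Q * L) * η * (1 + ‖z‖ ^ 2) := by ring
      _ ≤ _ := by
          gcongr
          have : 0 ≤ 2 * (Q * G) ^ 2 := by positivity
          linarith

/-- The action functional of a path with derivative `u`, with drift frozen along `q` and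
diffusion frozen along `p`. -/
noncomputable def frozenAction (T : ℝ) (b : E → E) (σ : E → (E →L[ℝ] E)) (p q u : ℝ → E) : ℝ :=
  (1 / 2) * ∫ t in (0 : ℝ)..T, lagrangian b σ (p t) (q t) (u t)

/-- `p` and `q` are measurable, and at time `s` they are bounded by any bound of `φ` up to
time `s + h`. -/
structure IsFreezing (T h : ℝ) (φ p q : ℝ → E) : Prop where
  meas_left : StronglyMeasurable p
  meas_right : StronglyMeasurable q
  bound_left : ∀ s ∈ Icc 0 T, ∀ C : ℝ, (∀ r ∈ Icc 0 T, r ≤ s + h → ‖φ r‖ ≤ C) → ‖p s‖ ≤ C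
  bound_right : ∀ s ∈ Icc 0 T, ∀ C : ℝ, (∀ r ∈ Icc 0 T, r ≤ s + h → ‖φ r‖ ≤ C) → ‖q s‖ ≤ C

lemma frozenAction_nonneg {T : ℝ} (hT : 0 < T) (b : E → E) (σ : E → (E →L[ℝ] E))
    (p q φ' : ℝ → E) : 0 ≤ frozenAction T b σ p q φ' :=
  mul_nonneg (by norm_num) (intervalIntegral.integral_nonneg hT.le fun _ _ => sq_nonneg _)

lemma isFreezing_self {X : Type*} [NormedAddCommGroup X] {T : ℝ} {φ : ℝ → X}
    (hφ : Continuous φ) : IsFreezing T 0 φ φ φ where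
  meas_left := hφ.stronglyMeasurable
  meas_right := hφ.stronglyMeasurable
  bound_left s hs _ hC := hC s hs (by simp)
  bound_right s hs _ hC := hC s hs (by simp)

lemma gridHat_le {h : ℝ} (hh : 0 < h) (t : ℝ) : gridHat h t ≤ t := by
  have := mul_le_mul_of_nonneg_left (Int.floor_le (t / h)) hh.le
  rwa [mul_div_cancel₀ _ hh.ne'] at this

lemma le_gridHat_add {h : ℝ} (hh : 0 < h) (t : ℝ) : t ≤ gridHat h t + h := by
  have := mul_le_mul_of_nonneg_left (Int.lt_floor_add_one (t / h)).le hh.le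
  rw [mul_div_cancel₀ _ hh.ne'] at this
  unfold gridHat
  linarith

lemma le_gridCheck {h : ℝ} (hh : 0 < h) (t : ℝ) : t ≤ gridCheck h t := by
  have := mul_le_mul_of_nonneg_left (Int.le_ceil (t / h)) hh.le
  rwa [mul_div_cancel₀ _ hh.ne'] at this

lemma gridCheck_le_add {h : ℝ} (hh : 0 < h) (t : ℝ) : gridCheck h t ≤ t + h := by
  have := mul_le_mul_of_nonneg_left (Int.ceil_lt_add_one (t / h)).le hh.le
  rw [mul_add, mul_div_cancel₀ _ hh.ne'] at this
  unfold gridCheck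
  linarith

lemma gridHat_mem_Icc {T : ℝ} (hT : 0 < T) {N : ℕ} (hN : 0 < N) {t : ℝ} (ht : t ∈ Icc 0 T) :
    gridHat (T / N) t ∈ Icc 0 T := by
  have hh : 0 < T / N := by positivity
  refine ⟨mul_nonneg hh.le ?_, (gridHat_le hh t).trans ht.2⟩
  exact_mod_cast Int.floor_nonneg.2 (div_nonneg ht.1 hh.le)

lemma gridCheck_mem_Icc {T : ℝ} (hT : 0 < T) {N : ℕ} (hN : 0 < N) {t : ℝ} (ht : t ∈ Icc 0 T) :
    gridCheck (T / N) t ∈ Icc 0 T := by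
  have hh : 0 < T / N := by positivity
  refine ⟨ht.1.trans (le_gridCheck hh t), ?_⟩
  have h1 : ⌈t / (T / N)⌉ ≤ (N : ℤ) := by
    rw [Int.ceil_le, div_le_iff₀ hh]
    have : ((N : ℤ) : ℝ) * (T / N) = T := by
      push_cast
      field_simp
    rw [this]
    exact ht.2
  calc gridCheck (T / N) t ≤ T / N * ((N : ℤ) : ℝ) := by
        unfold gridCheck
        gcongr
    _ = T := by
        push_cast
        field_simp

lemma measurable_gridHat (h : ℝ) : Measurable (gridHat h) := by
  have : Measurable fun t : ℝ => h * ((⌊t / h⌋ : ℤ) : ℝ) := by fun_prop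
  exact this

lemma measurable_gridCheck (h : ℝ) : Measurable (gridCheck h) := by
  have : Measurable fun t : ℝ => h * ((⌈t / h⌉ : ℤ) : ℝ) := by fun_prop
  exact this

lemma isFreezing_grid {T : ℝ} (hT : 0 < T) {N : ℕ} (hN : 0 < N) {θ : ℝ} (hθ0 : 0 ≤ θ)
    (hθ1 : θ ≤ 1) {φ : ℝ → E} (hφ : Continuous φ) :
    IsFreezing T (T / N) φ (fun t => φ (gridHat (T / N) t))
      (fun t => (1 - θ) • φ (gridHat (T / N) t) + θ • φ (gridCheck (T / N) t)) := by
  have hh : 0 < T / N := by positivity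
  have m1 : StronglyMeasurable fun t => φ (gridHat (T / N) t) :=
    hφ.stronglyMeasurable.comp_measurable (measurable_gridHat _)
  have m2 : StronglyMeasurable fun t => φ (gridCheck (T / N) t) :=
    hφ.stronglyMeasurable.comp_measurable (measurable_gridCheck _)
  refine ⟨m1, (m1.const_smul _).add (m2.const_smul _), fun s hs C hC => ?_, fun s hs C hC => ?_⟩
  · exact hC _ (gridHat_mem_Icc hT hN hs) ((gridHat_le hh s).trans (by linarith))
  · have h1 := hC _ (gridHat_mem_Icc hT hN hs) ((gridHat_le hh s).trans (by linarith))
    have h2 := hC _ (gridCheck_mem_Icc hT hN hs) (gridCheck_le_add hh s)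
    simpa using convex_closedBall (0 : E) C (mem_closedBall_zero_iff.2 h1)
      (mem_closedBall_zero_iff.2 h2) (sub_nonneg.2 hθ1) hθ0 (by ring)

lemma isSobolevPath_segment [CompleteSpace E] {T : ℝ} (hT : 0 < T) (x₀ x : E) :
    IsSobolevPath T x₀ x (fun t => x₀ + t • (T⁻¹ • (x - x₀))) fun _ => T⁻¹ • (x - x₀) where
  cont := by fun_prop
  int := integrableOn_const (by simp)
  sq_int := integrableOn_const (by simp)
  eq_integral t _ := by rw [intervalIntegral.integral_const, sub_zero]
  endpoint := by simp [smul_smul, hT.ne']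

section Finite

variable [ProperSpace E] {L : NNReal} {b : E → E} {σ : E → (E →L[ℝ] E)}

lemma integrableOn_lagrangian (hb : LipschitzWith L b) (hσ : LipschitzWith L σ)
    (hb0 : ‖b 0‖ ≤ L) (hinv : ∀ x, IsUnit (σ x)) {T h : ℝ} {x₀ x : E} {φ φ' p q : ℝ → E}
    (hφ : IsSobolevPath T x₀ x φ φ') (hf : IsFreezing T h φ p q) :
    IntegrableOn (fun t => lagrangian b σ (p t) (q t) (φ' t)) (Icc 0 T) := by
  obtain ⟨C, hC⟩ := (isCompact_Icc (a := (0 : ℝ)) (b := T)).exists_bound_of_continuousOn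
    hφ.cont.continuousOn
  obtain ⟨D, -, hD, -⟩ := exists_lagrangian_bounds hb hσ hb0 hinv (le_max_right C 0)
  have hdom : IntegrableOn (fun t => D * (1 + ‖φ' t‖ ^ 2)) (Icc 0 T) :=
    ((integrableOn_const (by simp)).add hφ.sq_int).const_mul D
  refine hdom.mono' ?_ ?_
  · have h1 : StronglyMeasurable fun t => Ring.inverse (σ (p t)) :=
      (continuous_inverse_comp hσ hinv).comp_stronglyMeasurable hf.meas_left
    have h2 : StronglyMeasurable fun t => b (q t) :=
      hb.continuous.comp_stronglyMeasurable hf.meas_right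
    have h3 : AEStronglyMeasurable (fun t => φ' t - b (q t)) (volume.restrict (Icc 0 T)) :=
      hφ.int.aestronglyMeasurable.sub h2.aestronglyMeasurable
    have h4 : AEStronglyMeasurable (fun t => (Ring.inverse (σ (p t))) (φ' t - b (q t)))
        (volume.restrict (Icc 0 T)) :=
      isBoundedBilinearMap_apply.continuous.comp_aestronglyMeasurable
        (h1.aestronglyMeasurable.prodMk h3)
    exact h4.norm.pow 2
  · refine (ae_restrict_iff' measurableSet_Icc).2 (Filter.Eventually.of_forall fun t ht => ?_)
    rw [lagrangian, Real.norm_of_nonneg (sq_nonneg _)]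
    exact hD _ _ _
      (hf.bound_left t ht _ fun r hr _ => (hC r hr).trans (le_max_left _ _))
      (hf.bound_right t ht _ fun r hr _ => (hC r hr).trans (le_max_left _ _))

/-- A priori bounds for paths of bounded action. -/
lemma IsSobolevPath.apriori (hL : 0 < L) (hb : LipschitzWith L b) (hσ : LipschitzWith L σ)
    (hb0 : ‖b 0‖ ≤ L) (hσ0 : ‖σ 0‖ ≤ L) (hinv : ∀ x, IsUnit (σ x)) {T : ℝ} (hT : 0 < T)
    {h M V B : ℝ} {x₀ x : E} {φ φ' p q : ℝ → E}
    (hφ : IsSobolevPath T x₀ x φ φ') (hf : IsFreezing T h φ p q) (hM : 0 ≤ M)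
    (hV : V = 2 * T + 4 * M) (hh : 18 * (L : ℝ) ^ 2 * V * h ≤ 1)
    (hB : B = 2 * (1 + ‖x₀‖) * Real.exp (18 * (L : ℝ) ^ 2 * V * T))
    (hact : frozenAction T b σ p q φ' ≤ M) :
    (∀ t ∈ Icc 0 T, ‖φ t‖ ≤ B) ∧ ∫ t in (0 : ℝ)..T, ‖φ' t‖ ^ 2 ≤ (L * (1 + B)) ^ 2 * V := by
  have hLr : (0 : ℝ) < L := by exact_mod_cast hL
  have hV0 : 0 < V := by linarith
  have h0 : (0 : ℝ) ∈ Icc 0 T := ⟨le_rfl, hT.le⟩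
  have hTT : T ∈ Icc 0 T := ⟨hT.le, le_rfl⟩
  set ℓ : ℝ → ℝ := fun t => lagrangian b σ (p t) (q t) (φ' t)
  set v : ℝ → ℝ := fun t => ‖(Ring.inverse (σ (p t))) (φ' t - b (q t))‖
  have hvℓ : ∀ t, v t ^ 2 = ℓ t := fun t => rfl
  have hint : IntegrableOn ℓ (Icc 0 T) := integrableOn_lagrangian hb hσ hb0 hinv hφ hf
  have hvm : AEStronglyMeasurable v (volume.restrict (Icc 0 T)) := by
    have : v = fun t => √(ℓ t) := by
      funext t
      rw [← hvℓ, Real.sqrt_sq (norm_nonneg _)]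
    rw [this]
    exact Real.continuous_sqrt.comp_aestronglyMeasurable hint.aestronglyMeasurable
  have hle : ∀ t, (1 + v t) ^ 2 ≤ 2 + 2 * ℓ t := fun t => by
    rw [← hvℓ]
    nlinarith [sq_nonneg (1 - v t)]
  have hdom : IntegrableOn (fun t => 2 + 2 * ℓ t) (Icc 0 T) :=
    (integrableOn_const (by simp)).add (hint.const_mul 2)
  have hv : IntegrableOn (fun t => (1 + v t) ^ 2) (Icc 0 T) := by
    refine hdom.mono' ((aestronglyMeasurable_const.add hvm).pow 2)
      (Filter.Eventually.of_forall fun t => ?_)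
    rw [Real.norm_of_nonneg (sq_nonneg _)]
    exact hle t
  have intervalInt : ∀ {f : ℝ → ℝ}, IntegrableOn f (Icc 0 T) → IntervalIntegrable f volume 0 T :=
    fun hf => (hf.mono_set (uIcc_subset_Icc h0 hTT)).intervalIntegrable
  have hvV : ∫ t in (0 : ℝ)..T, (1 + v t) ^ 2 ≤ V := by
    calc _ ≤ ∫ t in (0 : ℝ)..T, (2 + 2 * ℓ t) :=
          intervalIntegral.integral_mono_on hT.le (intervalInt hv) (intervalInt hdom) fun t _ => hle t
      _ = 2 * T + 2 * ∫ t in (0 : ℝ)..T, ℓ t := by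
          rw [intervalIntegral.integral_add intervalIntegrable_const ((intervalInt hint).const_mul 2),
            intervalIntegral.integral_const_mul, intervalIntegral.integral_const, smul_eq_mul]
          ring
      _ ≤ V := by
          have : (1 / 2) * ∫ t in (0 : ℝ)..T, ℓ t ≤ M := hact
          linarith
  have hctrl : ∀ s ∈ Icc 0 T, ∀ C : ℝ, (∀ r ∈ Icc 0 T, r ≤ s + h → 1 + ‖φ r‖ ≤ C) →
      ‖φ' s‖ ≤ L * C * (1 + v s) := by
    intro s hs C hC
    have hp : 1 + ‖p s‖ ≤ C := by
      linarith [hf.bound_left s hs (C - 1) fun r hr hrs => by linarith [hC r hr hrs]]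
    have hq : 1 + ‖q s‖ ≤ C := by
      linarith [hf.bound_right s hs (C - 1) fun r hr hrs => by linarith [hC r hr hrs]]
    have e : φ' s = b (q s) + σ (p s) ((Ring.inverse (σ (p s))) (φ' s - b (q s))) := by
      rw [← mul_apply_eq_comp, Ring.mul_inverse_cancel _ (hinv _)]
      simp
    calc ‖φ' s‖ ≤ ‖b (q s)‖ + ‖σ (p s)‖ * v s := by
          conv_lhs => rw [e]
          exact (norm_add_le _ _).trans
            (add_le_add le_rfl (ContinuousLinearMap.le_opNorm _ _))
      _ ≤ L * C + L * C * v s := by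
          gcongr
          · exact (norm_le_of_lipschitz hb hb0 _).trans (by gcongr)
          · exact (norm_le_of_lipschitz hσ hσ0 _).trans (by gcongr)
      _ = _ := by ring
  have hbd := hφ.norm_le_of_control hT hLr hV0 hh hv hvV hctrl
  rw [← hB] at hbd
  have hbd' : ∀ t ∈ Icc 0 T, ‖φ t‖ ≤ B := fun t ht => by linarith [hbd t ht]
  refine ⟨hbd', ?_⟩
  calc ∫ t in (0 : ℝ)..T, ‖φ' t‖ ^ 2
      ≤ ∫ t in (0 : ℝ)..T, (L * (1 + B)) ^ 2 * (1 + v t) ^ 2 := by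
        refine intervalIntegral.integral_mono_on hT.le (intervalInt hφ.sq_int)
          ((intervalInt hv).const_mul _) fun t ht => ?_
        rw [← mul_pow]
        exact pow_le_pow_left₀ (norm_nonneg _)
          (hctrl t ht _ fun r hr _ => by linarith [hbd' r hr]) 2
    _ ≤ _ := by
        rw [intervalIntegral.integral_const_mul]
        gcongr

lemma abs_frozenAction_sub_le (hb : LipschitzWith L b) (hσ : LipschitzWith L σ)
    (hb0 : ‖b 0‖ ≤ L) (hinv : ∀ x, IsUnit (σ x)) {T : ℝ} (hT : 0 < T)
    {h h₁ D η C : ℝ} {x₀ x : E} {φ φ' p q p₁ q₁ : ℝ → E}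
    (hφ : IsSobolevPath T x₀ x φ φ') (hf : IsFreezing T h φ p q) (hf₁ : IsFreezing T h₁ φ p₁ q₁)
    (hD : 0 ≤ D * η) (hC : ∫ t in (0 : ℝ)..T, ‖φ' t‖ ^ 2 ≤ C)
    (hle : ∀ t ∈ Icc 0 T, |lagrangian b σ (p t) (q t) (φ' t)
      - lagrangian b σ (p₁ t) (q₁ t) (φ' t)| ≤ D * η * (1 + ‖φ' t‖ ^ 2)) :
    |frozenAction T b σ p q φ' - frozenAction T b σ p₁ q₁ φ'| ≤ D * (T + C) * η := by
  have h0 : (0 : ℝ) ∈ Icc 0 T := ⟨le_rfl, hT.le⟩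
  have hTT : T ∈ Icc 0 T := ⟨hT.le, le_rfl⟩
  have intervalInt : ∀ {f : ℝ → ℝ}, IntegrableOn f (Icc 0 T) → IntervalIntegrable f volume 0 T :=
    fun hf => (hf.mono_set (uIcc_subset_Icc h0 hTT)).intervalIntegrable
  have i1 := intervalInt (integrableOn_lagrangian hb hσ hb0 hinv hφ hf)
  have i2 := intervalInt (integrableOn_lagrangian hb hσ hb0 hinv hφ hf₁)
  have i3 := intervalInt hφ.sq_int
  have hC0 : 0 ≤ C :=
    le_trans (intervalIntegral.integral_nonneg hT.le fun r _ => by positivity) hC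
  unfold frozenAction
  rw [← mul_sub, ← intervalIntegral.integral_sub i1 i2, abs_mul, abs_of_pos (by norm_num)]
  calc _ ≤ 1 / 2 * ∫ t in (0 : ℝ)..T, D * η * (1 + ‖φ' t‖ ^ 2) := by
        gcongr
        refine (intervalIntegral.abs_integral_le_integral_abs hT.le).trans ?_
        exact intervalIntegral.integral_mono_on hT.le (i1.sub i2).abs
          ((intervalIntegrable_const.add i3).const_mul _) hle
    _ = 1 / 2 * (D * η * (T + ∫ t in (0 : ℝ)..T, ‖φ' t‖ ^ 2)) := by
        rw [intervalIntegral.integral_const_mul,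
          intervalIntegral.integral_add intervalIntegrable_const i3,
          intervalIntegral.integral_const, smul_eq_mul]
        ring
    _ ≤ 1 / 2 * (D * η * (T + C)) := by gcongr
    _ ≤ D * η * (T + C) := by
        have : 0 ≤ D * η * (T + C) := mul_nonneg hD (by linarith)
        linarith
    _ = _ := by ring

/-- On bounded sets of paths, freezing along the grid changes the action by `O(√h)`. -/
lemma exists_abs_frozenAction_grid_sub_le (hb : LipschitzWith L b) (hσ : LipschitzWith L σ)
    (hb0 : ‖b 0‖ ≤ L) (hinv : ∀ x, IsUnit (σ x)) {T : ℝ} (hT : 0 < T) {θ : ℝ} (hθ0 : 0 ≤ θ)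
    (hθ1 : θ ≤ 1) {B C : ℝ} (hB : 0 ≤ B) (hC : 0 ≤ C) :
    ∃ K : ℝ, 0 ≤ K ∧ ∀ N : ℕ, 0 < N → ∀ (x₀ x : E) (φ φ' : ℝ → E),
      IsSobolevPath T x₀ x φ φ' → (∀ t ∈ Icc 0 T, ‖φ t‖ ≤ B) →
      ∫ t in (0 : ℝ)..T, ‖φ' t‖ ^ 2 ≤ C →
      |frozenAction T b σ (fun t => φ (gridHat (T / N) t))
          (fun t => (1 - θ) • φ (gridHat (T / N) t) + θ • φ (gridCheck (T / N) t)) φ'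
        - frozenAction T b σ φ φ φ'| ≤ K * √(T / N) := by
  obtain ⟨D, hD0, -, hD⟩ := exists_lagrangian_bounds hb hσ hb0 hinv hB
  refine ⟨D * (T + C) * (1 + C), by positivity, fun N hN x₀ x φ φ' hφ hφB hφC => ?_⟩
  have hh : 0 < T / N := by positivity
  have hf := isFreezing_grid hT hN hθ0 hθ1 hφ.cont
  rw [mul_assoc]
  refine abs_frozenAction_sub_le hb hσ hb0 hinv hT hφ hf (isFreezing_self hφ.cont)
    (by positivity) hφC fun t ht => ?_
  have m1 := gridHat_mem_Icc hT hN ht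
  have m2 := gridCheck_mem_Icc hT hN ht
  have d1 : ‖φ (gridHat (T / N) t) - φ t‖ ≤ (1 + C) * √(T / N) := by
    rw [norm_sub_rev]
    exact hφ.norm_sub_le hh hφC m1 ht (gridHat_le hh t) (le_gridHat_add hh t)
  have d2 : ‖φ (gridCheck (T / N) t) - φ t‖ ≤ (1 + C) * √(T / N) :=
    hφ.norm_sub_le hh hφC ht m2 (le_gridCheck hh t) (gridCheck_le_add hh t)
  refine hD _ _ _ _ _ _ (hφB _ m1) (hf.bound_right t ht B fun r hr _ => hφB r hr)
    (hφB t ht) (hφB t ht) d1 ?_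
  rw [← dist_eq_norm, ← Metric.mem_closedBall]
  exact convex_closedBall (φ t) _ (by rwa [Metric.mem_closedBall, dist_eq_norm])
    (by rwa [Metric.mem_closedBall, dist_eq_norm]) (sub_nonneg.2 hθ1) hθ0 (by ring)

/-- The straight segment has bounded action, uniformly in the endpoint and the freezing. -/
lemma exists_frozenAction_segment_le (hb : LipschitzWith L b) (hσ : LipschitzWith L σ)
    (hb0 : ‖b 0‖ ≤ L) (hinv : ∀ x, IsUnit (σ x)) {T : ℝ} (hT : 0 < T) (x₀ : E) (R : ℝ)
    (hR : 0 < R) :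
    ∃ M : ℝ, 0 ≤ M ∧ ∀ (x : E) (h : ℝ) (p q : ℝ → E), ‖x‖ ≤ R →
      IsFreezing T h (fun t => x₀ + t • (T⁻¹ • (x - x₀))) p q →
      frozenAction T b σ p q (fun _ => T⁻¹ • (x - x₀)) ≤ M := by
  have hC0 : 0 ≤ ‖x₀‖ + (R + ‖x₀‖) := by positivity
  obtain ⟨D, hD0, hD, -⟩ := exists_lagrangian_bounds hb hσ hb0 hinv hC0
  refine ⟨1 / 2 * (D * (1 + (T⁻¹ * (R + ‖x₀‖)) ^ 2) * T), by positivity,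
    fun x h p q hx hf => ?_⟩
  have hxx : ‖x - x₀‖ ≤ R + ‖x₀‖ := (norm_sub_le _ _).trans (by gcongr)
  have hz : ‖T⁻¹ • (x - x₀)‖ ≤ T⁻¹ * (R + ‖x₀‖) := by
    rw [norm_smul, Real.norm_of_nonneg (by positivity)]
    gcongr
  have hball : ∀ r ∈ Icc 0 T, ‖x₀ + r • (T⁻¹ • (x - x₀))‖ ≤ ‖x₀‖ + (R + ‖x₀‖) := by
    intro r hr
    refine (norm_add_le _ _).trans ?_
    gcongr
    rw [norm_smul, Real.norm_of_nonneg hr.1]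
    calc r * ‖T⁻¹ • (x - x₀)‖ ≤ T * (T⁻¹ * (R + ‖x₀‖)) := by
          gcongr
          exact hr.2
      _ = _ := by field_simp
  have hi : IntervalIntegrable (fun t => lagrangian b σ (p t) (q t) (T⁻¹ • (x - x₀)))
      volume 0 T :=
    ((integrableOn_lagrangian hb hσ hb0 hinv (isSobolevPath_segment hT x₀ x) hf).mono_set
      (uIcc_subset_Icc ⟨le_rfl, hT.le⟩ ⟨hT.le, le_rfl⟩)).intervalIntegrable
  unfold frozenAction
  gcongr
  calc _ ≤ ∫ _t in (0 : ℝ)..T, D * (1 + (T⁻¹ * (R + ‖x₀‖)) ^ 2) := by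
        refine intervalIntegral.integral_mono_on hT.le hi intervalIntegrable_const fun t ht => ?_
        refine (hD _ _ _ (hf.bound_left t ht _ fun r hr _ => hball r hr)
          (hf.bound_right t ht _ fun r hr _ => hball r hr)).trans ?_
        gcongr
    _ = _ := by
        rw [intervalIntegral.integral_const, smul_eq_mul]
        ring

end Finite

lemma csInf_le_csInf_add {S S' : Set ℝ} {M κ : ℝ} (hκ : 0 ≤ κ) (hS : S.Nonempty)
    (hS' : ∀ r ∈ S', 0 ≤ r) {s : ℝ} (hs : s ∈ S') (hsM : s ≤ M)
    (H : ∀ r ∈ S, r ≤ M → ∃ r' ∈ S', r' ≤ r + κ) : sInf S' ≤ sInf S + κ := by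
  have hbdd : BddBelow S' := ⟨0, hS'⟩
  rw [← sub_le_iff_le_add]
  refine le_csInf hS fun r hr => ?_
  rw [sub_le_iff_le_add]
  rcases le_total r M with h | h
  · obtain ⟨r', hr', hle⟩ := H r hr h
    exact (csInf_le hbdd hr').trans hle
  · exact (csInf_le hbdd hs).trans (by linarith)

end Helpers

lemma mem_rateValues_iff {d : ℕ} {T : ℝ} (hT : 0 < T) {x₀ x : EuclideanSpace ℝ (Fin d)}
    {b : EuclideanSpace ℝ (Fin d) → EuclideanSpace ℝ (Fin d)}
    {σ : EuclideanSpace ℝ (Fin d) →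
      (EuclideanSpace ℝ (Fin d) →L[ℝ] EuclideanSpace ℝ (Fin d))} {r : ℝ} :
    r ∈ rateValues d T x₀ b σ x ↔
      ∃ φ φ', IsSobolevPath T x₀ x φ φ' ∧ r = frozenAction T b σ φ φ φ' := by
  constructor
  · rintro ⟨φ, φ', h1, h2, h3, h4, rfl⟩
    obtain ⟨ψ, hψ, heq⟩ := exists_isSobolevPath_eqOn hT h1 h2 h3 h4
    refine ⟨ψ, φ', hψ, congrArg _ (intervalIntegral.integral_congr fun t ht => ?_)⟩
    rw [uIcc_of_le hT.le] at ht
    simp only [lagrangian, heq t ht]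
  · rintro ⟨φ, φ', hφ, rfl⟩
    exact ⟨φ, φ', hφ.int, hφ.sq_int, hφ.eq_integral, hφ.endpoint, rfl⟩

lemma mem_rateValuesH_iff {d : ℕ} {T : ℝ} (hT : 0 < T) {x₀ x : EuclideanSpace ℝ (Fin d)} {θ : ℝ}
    {b : EuclideanSpace ℝ (Fin d) → EuclideanSpace ℝ (Fin d)}
    {σ : EuclideanSpace ℝ (Fin d) →
      (EuclideanSpace ℝ (Fin d) →L[ℝ] EuclideanSpace ℝ (Fin d))} {N : ℕ} (hN : 0 < N) {r : ℝ} :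
    r ∈ rateValuesH d T x₀ θ b σ (T / N) x ↔
      ∃ φ φ', IsSobolevPath T x₀ x φ φ' ∧
        r = frozenAction T b σ (fun t => φ (gridHat (T / N) t))
          (fun t => (1 - θ) • φ (gridHat (T / N) t) + θ • φ (gridCheck (T / N) t)) φ' := by
  constructor
  · rintro ⟨φ, φ', h1, h2, h3, h4, rfl⟩
    obtain ⟨ψ, hψ, heq⟩ := exists_isSobolevPath_eqOn hT h1 h2 h3 h4
    refine ⟨ψ, φ', hψ, congrArg _ (intervalIntegral.integral_congr fun t ht => ?_)⟩
    rw [uIcc_of_le hT.le] at ht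
    simp only [lagrangian, heq _ (gridHat_mem_Icc hT hN ht), heq _ (gridCheck_mem_Icc hT hN ht)]
  · rintro ⟨φ, φ', hφ, rfl⟩
    exact ⟨φ, φ', hφ.int, hφ.sq_int, hφ.eq_integral, hφ.endpoint, rfl⟩

/-- Convergence of order 1/2 of the discrete rate function `I^h` of the
stochastic θ-method to the rate function `I`, uniformly on bounded sets: for every
`R > 0` there is `K₁(R) > 0` such that for all `h = T/N ∈ (0, min(1/(2L),1)]`,
`sup_{|x| ≤ R} |I^h(x) − I(x)| ≤ K₁(R) h^{1/2}`. -/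
theorem discrete_rate_function_convergence_multiplicative
    (d : ℕ) (hd : 1 ≤ d) (T : ℝ) (hT : 0 < T)
    (x₀ : EuclideanSpace ℝ (Fin d)) (L : NNReal) (hL : 0 < L)
    (θ : ℝ) (hθ0 : 0 ≤ θ) (hθ1 : θ ≤ 1)
    (b : EuclideanSpace ℝ (Fin d) → EuclideanSpace ℝ (Fin d))
    (σ : EuclideanSpace ℝ (Fin d) →
      (EuclideanSpace ℝ (Fin d) →L[ℝ] EuclideanSpace ℝ (Fin d)))
    (hb : LipschitzWith L b) (hσ : LipschitzWith L σ)
    (hbound : ‖b 0‖ + ‖σ 0‖ ≤ (L : ℝ))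
    (hinv : ∀ x, IsUnit (σ x)) :
    ∀ R : ℝ, 0 < R → ∃ K₁ : ℝ, 0 < K₁ ∧
      ∀ N : ℕ, 0 < N → T / (N : ℝ) ≤ min (1 / (2 * (L : ℝ))) 1 →
      ∀ x : EuclideanSpace ℝ (Fin d), ‖x‖ ≤ R →
        |sInf (rateValuesH d T x₀ θ b σ (T / (N : ℝ)) x) -
          sInf (rateValues d T x₀ b σ x)| ≤ K₁ * Real.sqrt (T / (N : ℝ)) := by
  intro R hR
  have hb0 : ‖b 0‖ ≤ L := by linarith [norm_nonneg (σ 0)]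
  have hσ0 : ‖σ 0‖ ≤ L := by linarith [norm_nonneg (b 0)]
  have hLr : (0 : ℝ) < L := by exact_mod_cast hL
  obtain ⟨M, hM0, hM⟩ := exists_frozenAction_segment_le hb hσ hb0 hinv hT x₀ R hR
  obtain ⟨V, hV⟩ : ∃ V, V = 2 * T + 4 * M := ⟨_, rfl⟩
  have hV0 : 0 < V := by linarith
  obtain ⟨B, hB⟩ : ∃ B, B = 2 * (1 + ‖x₀‖) * Real.exp (18 * (L : ℝ) ^ 2 * V * T) := ⟨_, rfl⟩
  have hB0 : 0 ≤ B := by rw [hB]; positivity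
  have hC0 : 0 ≤ (L * (1 + B)) ^ 2 * V := by positivity
  obtain ⟨K, hK0, hK⟩ := exists_abs_frozenAction_grid_sub_le hb hσ hb0 hinv hT hθ0 hθ1 hB0 hC0
  set l := 18 * (L : ℝ) ^ 2 * V with hl
  have hl0 : 0 < l := by positivity
  refine ⟨K + M * √l + 1, by positivity, fun N hN _ x hx => ?_⟩
  have hh : 0 < T / N := by positivity
  have hseg := isSobolevPath_segment hT x₀ x
  have hA := (mem_rateValues_iff (b := b) (σ := σ) hT).2 ⟨_, _, hseg, rfl⟩
  have hAM := hM x _ _ _ hx (isFreezing_self hseg.cont)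
  have hH := (mem_rateValuesH_iff (θ := θ) (b := b) (σ := σ) hT hN).2 ⟨_, _, hseg, rfl⟩
  have hHM := hM x _ _ _ hx (isFreezing_grid hT hN hθ0 hθ1 hseg.cont)
  have hAnn : ∀ r ∈ rateValues d T x₀ b σ x, 0 ≤ r := fun r hr => by
    obtain ⟨φ, φ', -, rfl⟩ := (mem_rateValues_iff hT).1 hr
    exact frozenAction_nonneg hT _ _ _ _ _
  have hHnn : ∀ r ∈ rateValuesH d T x₀ θ b σ (T / N) x, 0 ≤ r := fun r hr => by
    obtain ⟨φ, φ', -, rfl⟩ := (mem_rateValuesH_iff hT hN).1 hr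
    exact frozenAction_nonneg hT _ _ _ _ _
  rcases le_total (l * (T / N)) 1 with hsmall | hlarge
  · have hκ : 0 ≤ K * √(T / N) := by positivity
    have u1 : sInf (rateValuesH d T x₀ θ b σ (T / N) x)
        ≤ sInf (rateValues d T x₀ b σ x) + K * √(T / N) := by
      refine csInf_le_csInf_add hκ ⟨_, hA⟩ hHnn hH hHM fun r hr hrM => ?_
      obtain ⟨φ, φ', hφ, rfl⟩ := (mem_rateValues_iff hT).1 hr
      obtain ⟨hφB, hφC⟩ := hφ.apriori hL hb hσ hb0 hσ0 hinv hT (isFreezing_self hφ.cont) hM0 hV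
        (by simp) hB hrM
      refine ⟨_, (mem_rateValuesH_iff hT hN).2 ⟨φ, φ', hφ, rfl⟩, ?_⟩
      linarith [(abs_le.1 (hK N hN x₀ x φ φ' hφ hφB hφC)).2]
    have u2 : sInf (rateValues d T x₀ b σ x)
        ≤ sInf (rateValuesH d T x₀ θ b σ (T / N) x) + K * √(T / N) := by
      refine csInf_le_csInf_add hκ ⟨_, hH⟩ hAnn hA hAM fun r hr hrM => ?_
      obtain ⟨φ, φ', hφ, rfl⟩ := (mem_rateValuesH_iff hT hN).1 hr
      obtain ⟨hφB, hφC⟩ := hφ.apriori hL hb hσ hb0 hσ0 hinv hT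
        (isFreezing_grid hT hN hθ0 hθ1 hφ.cont) hM0 hV hsmall hB hrM
      refine ⟨_, (mem_rateValues_iff hT).2 ⟨φ, φ', hφ, rfl⟩, ?_⟩
      linarith [(abs_le.1 (hK N hN x₀ x φ φ' hφ hφB hφC)).1]
    have u3 : 0 ≤ (M * √l + 1) * √(T / N) := by positivity
    rw [abs_le]
    constructor <;> linarith
  · have u1 := Real.sInf_nonneg hAnn
    have u2 := Real.sInf_nonneg hHnn
    have u3 := (csInf_le ⟨0, hAnn⟩ hA).trans hAM
    have u4 := (csInf_le ⟨0, hHnn⟩ hH).trans hHM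
    have u5 : 1 ≤ √l * √(T / N) := by
      rw [← Real.sqrt_mul hl0.le]
      exact Real.one_le_sqrt.2 hlarge
    have u6 : M ≤ M * (√l * √(T / N)) := le_mul_of_one_le_right hM0 u5
    have u7 : 0 ≤ (K + 1) * √(T / N) := by positivity
    rw [abs_le]
    constructor <;> linarith
end

section
/- Let b : ℝ^d → ℝ^d and σ : ℝ^d → ℝ^{d×d} be globally Lipschitz with constant L and satisfy |b(0)| + |σ(0)| ≤ L, and suppose σ(x) is invertible for every x ∈ ℝ^d. Let φ : [0,T] → ℝ^d be continuous with φ(0) = x₀. Then there exists f ∈ L²(0,T;ℝ^d) such that φ(t) = x₀ + ∫₀^t b(φ(s)) ds + ∫₀^t σ(φ(s)) f(s) ds for all t ∈ [0,T] if and only if φ is absolutely continuous with φ' ∈ L²(0,T;ℝ^d); moreover, in that case the infimum of (1/2)∫₀^T |f(t)|² dt over all such f equals A(φ) = (1/2)∫₀^T |σ(φ(t))^{-1}(φ'(t) − b(φ(t)))|² dt. -/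
open MeasureTheory Set

section
variable {E F : Type*} [NormedAddCommGroup E] [NormedAddCommGroup F] {a b : ℝ}

/-- On a bounded interval, a function is square integrable iff it is in `L²`. -/
theorem integrableOn_and_integrableOn_sq_iff_memLp {g : ℝ → E} :
    (IntegrableOn g (Icc a b) ∧ IntegrableOn (fun t => ‖g t‖ ^ 2) (Icc a b)) ↔
      MemLp g 2 (volume.restrict (Icc a b)) := by
  refine ⟨fun h => (memLp_two_iff_integrable_sq_norm h.1.aestronglyMeasurable).2 h.2, fun h => ?_⟩
  exact ⟨h.integrable one_le_two, (memLp_two_iff_integrable_sq_norm h.aestronglyMeasurable).1 h⟩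

/-- A continuous function on a compact interval is in every `Lᵖ`. -/
theorem ContinuousOn.memLp_Icc {p : ENNReal} {g : ℝ → E} (hg : ContinuousOn g (Icc a b)) :
    MemLp g p (volume.restrict (Icc a b)) := by
  obtain ⟨C, hC⟩ := isCompact_Icc.exists_bound_of_continuousOn hg
  refine MemLp.of_bound (hg.aestronglyMeasurable_of_isCompact isCompact_Icc measurableSet_Icc) C ?_
  filter_upwards [ae_restrict_mem measurableSet_Icc] with t ht using hC t ht

variable [NormedSpace ℝ E] [NormedSpace ℝ F]

/-- Applying a continuous family of operators preserves `Lᵖ` on a compact interval. -/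
theorem MeasureTheory.MemLp.continuousOn_clm_apply {p : ENNReal} {A : ℝ → E →L[ℝ] F} {g : ℝ → E}
    (hA : ContinuousOn A (Icc a b)) (hg : MemLp g p (volume.restrict (Icc a b))) :
    MemLp (fun t => A t (g t)) p (volume.restrict (Icc a b)) := by
  obtain ⟨C, hC⟩ := isCompact_Icc.exists_bound_of_continuousOn hA
  have hAm : AEStronglyMeasurable A (volume.restrict (Icc a b)) :=
    hA.aestronglyMeasurable_of_isCompact isCompact_Icc measurableSet_Icc
  refine hg.of_le_mul (c := C)
    ((ContinuousLinearMap.id ℝ (E →L[ℝ] F)).aestronglyMeasurable_comp₂ hAm hg.1) ?_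
  filter_upwards [ae_restrict_mem measurableSet_Icc] with t ht
  exact (A t).le_of_opNorm_le (hC t ht) _

/-- Two integrable functions with the same primitive agree almost everywhere. -/
theorem ae_eq_of_forall_intervalIntegral_eq [CompleteSpace E] {u v : ℝ → E} (hab : a ≤ b)
    (hu : IntegrableOn u (Icc a b)) (hv : IntegrableOn v (Icc a b))
    (h : ∀ t ∈ Icc a b, ∫ s in a..t, u s = ∫ s in a..t, v s) :
    u =ᵐ[volume.restrict (Icc a b)] v := by
  have hu' := ((intervalIntegrable_iff_integrableOn_Icc_of_le hab).2 hu).ae_hasDerivAt_integral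
  have hv' := ((intervalIntegrable_iff_integrableOn_Icc_of_le hab).2 hv).ae_hasDerivAt_integral
  rw [← restrict_Ioo_eq_restrict_Icc]
  filter_upwards [ae_restrict_mem measurableSet_Ioo, ae_restrict_of_ae hu', ae_restrict_of_ae hv']
    with t ht hut hvt
  rw [uIcc_of_le hab] at hut hvt
  have ha : a ∈ Icc a b := left_mem_Icc.2 hab
  refine (hut (Ioo_subset_Icc_self ht) a ha).unique
    ((hvt (Ioo_subset_Icc_self ht) a ha).congr_of_eventuallyEq ?_)
  filter_upwards [Icc_mem_nhds ht.1 ht.2] with s hs using h s hs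

/-- Functions agreeing almost everywhere on an interval have the same primitive there. -/
theorem intervalIntegral_congr_of_ae_eq_restrict_Icc {u v : ℝ → E}
    (h : u =ᵐ[volume.restrict (Icc a b)] v) {t : ℝ} (ht : t ∈ Icc a b) :
    ∫ s in a..t, u s = ∫ s in a..t, v s := by
  refine intervalIntegral.integral_congr_ae_restrict ?_
  rw [uIoc_of_le ht.1]
  exact ae_restrict_of_ae_restrict_of_subset
    (Ioc_subset_Icc_self.trans (Icc_subset_Icc_right ht.2)) h

/-- Splitting off the drift in the primitive of an integrable sum. -/
theorem integral_add_of_integrableOn_Icc {u v : ℝ → E}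
    (hu : IntegrableOn u (Icc a b)) (hv : IntegrableOn v (Icc a b)) {t : ℝ} (ht : t ∈ Icc a b) :
    ∫ s in a..t, (u s + v s) = (∫ s in a..t, u s) + ∫ s in a..t, v s := by
  have hsub : Icc a t ⊆ Icc a b := Icc_subset_Icc_right ht.2
  exact intervalIntegral.integral_add
    ((intervalIntegrable_iff_integrableOn_Icc_of_le ht.1).2 (hu.mono_set hsub))
    ((intervalIntegrable_iff_integrableOn_Icc_of_le ht.1).2 (hv.mono_set hsub))

/-- Controls driving a path with square integrable derivative `φ'` are a.e. unique: they are
given by inverting the diffusion coefficient. -/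
theorem control_iff_ae_eq [CompleteSpace E] (hab : a ≤ b) {φ β φ' f : ℝ → E} {A : ℝ → E →L[ℝ] E}
    {x₀ : E} (hA : ContinuousOn A (Icc a b)) (hinv : ∀ t, IsUnit (A t))
    (hβ : ContinuousOn β (Icc a b))
    (hφ' : MemLp φ' 2 (volume.restrict (Icc a b)))
    (hf : MemLp f 2 (volume.restrict (Icc a b)))
    (hφ : ∀ t ∈ Icc a b, φ t = x₀ + ∫ s in a..t, φ' s) :
    (∀ t ∈ Icc a b, φ t = x₀ + (∫ s in a..t, β s) + ∫ s in a..t, A s (f s)) ↔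
      f =ᵐ[volume.restrict (Icc a b)] fun t => Ring.inverse (A t) (φ' t - β t) := by
  have hβi : IntegrableOn β (Icc a b) := hβ.integrableOn_Icc
  have hAf : IntegrableOn (fun t => A t (f t)) (Icc a b) :=
    (hf.continuousOn_clm_apply hA).integrable one_le_two
  have hφi : IntegrableOn φ' (Icc a b) := hφ'.integrable one_le_two
  have key : (φ' =ᵐ[volume.restrict (Icc a b)] fun t => β t + A t (f t)) ↔
      f =ᵐ[volume.restrict (Icc a b)] fun t => Ring.inverse (A t) (φ' t - β t) := by
    refine Filter.eventually_congr (Filter.Eventually.of_forall fun t => ?_)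
    dsimp only
    constructor
    · intro h
      rw [h, add_sub_cancel_left, ← mul_apply_eq_comp,
        Ring.inverse_mul_cancel _ (hinv t), one_apply_eq_self]
    · intro h
      rw [h, ← mul_apply_eq_comp, Ring.mul_inverse_cancel _ (hinv t),
        one_apply_eq_self, add_sub_cancel]
  rw [← key]
  constructor
  · intro h
    refine ae_eq_of_forall_intervalIntegral_eq hab hφi (hβi.add hAf) fun t ht => ?_
    have := h t ht
    rw [hφ t ht, add_assoc, ← integral_add_of_integrableOn_Icc hβi hAf ht] at this
    exact add_left_cancel this
  · intro h t ht
    rw [hφ t ht, add_assoc, ← integral_add_of_integrableOn_Icc hβi hAf ht,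
      intervalIntegral_congr_of_ae_eq_restrict_Icc h ht]

end

open MeasureTheory Set

/-- For a continuous `φ` with `φ(0) = x₀`, there exists `f ∈ L²(0,T;ℝ^d)`
with `φ(t) = x₀ + ∫₀ᵗ b(φ(s)) ds + ∫₀ᵗ σ(φ(s)) f(s) ds` iff `φ` is absolutely continuous
with `φ' ∈ L²`; and in that case the infimum of `½∫₀ᵀ|f|²` over all such `f` equals
`A(φ) = ½∫₀ᵀ |σ(φ(t))⁻¹(φ'(t) − b(φ(t)))|² dt`. -/
theorem skeleton_functional_domain_and_value
    (d : ℕ) (hd : 1 ≤ d) (T : ℝ) (hT : 0 < T)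
    (x₀ : EuclideanSpace ℝ (Fin d)) (L : NNReal) (hL : 0 < L)
    (b : EuclideanSpace ℝ (Fin d) → EuclideanSpace ℝ (Fin d))
    (σ : EuclideanSpace ℝ (Fin d) →
      (EuclideanSpace ℝ (Fin d) →L[ℝ] EuclideanSpace ℝ (Fin d)))
    (hb : LipschitzWith L b) (hσ : LipschitzWith L σ)
    (hbound : ‖b 0‖ + ‖σ 0‖ ≤ (L : ℝ))
    (hinv : ∀ x, IsUnit (σ x))
    (φ : ℝ → EuclideanSpace ℝ (Fin d))
    (hφcont : ContinuousOn φ (Icc 0 T)) (hφ0 : φ 0 = x₀) :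
    ((∃ f : ℝ → EuclideanSpace ℝ (Fin d),
        IntegrableOn f (Icc 0 T) ∧
        IntegrableOn (fun t => ‖f t‖ ^ 2) (Icc 0 T) ∧
        ∀ t ∈ Icc (0 : ℝ) T, φ t = x₀ + (∫ s in (0 : ℝ)..t, b (φ s))
          + ∫ s in (0 : ℝ)..t, (σ (φ s)) (f s)) ↔
      (∃ φ' : ℝ → EuclideanSpace ℝ (Fin d),
        IntegrableOn φ' (Icc 0 T) ∧
        IntegrableOn (fun t => ‖φ' t‖ ^ 2) (Icc 0 T) ∧
        ∀ t ∈ Icc (0 : ℝ) T, φ t = x₀ + ∫ s in (0 : ℝ)..t, φ' s)) ∧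
    (∀ φ' : ℝ → EuclideanSpace ℝ (Fin d),
      IntegrableOn φ' (Icc 0 T) →
      IntegrableOn (fun t => ‖φ' t‖ ^ 2) (Icc 0 T) →
      (∀ t ∈ Icc (0 : ℝ) T, φ t = x₀ + ∫ s in (0 : ℝ)..t, φ' s) →
      sInf {r : ℝ | ∃ f : ℝ → EuclideanSpace ℝ (Fin d),
          IntegrableOn f (Icc 0 T) ∧
          IntegrableOn (fun t => ‖f t‖ ^ 2) (Icc 0 T) ∧
          (∀ t ∈ Icc (0 : ℝ) T, φ t = x₀ + (∫ s in (0 : ℝ)..t, b (φ s))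
            + ∫ s in (0 : ℝ)..t, (σ (φ s)) (f s)) ∧
          r = (1 / 2) * ∫ t in (0 : ℝ)..T, ‖f t‖ ^ 2} =
        (1 / 2) * ∫ t in (0 : ℝ)..T,
          ‖(Ring.inverse (σ (φ t))) (φ' t - b (φ t))‖ ^ 2) := by
  have hA : ContinuousOn (fun t => σ (φ t)) (Icc 0 T) := hσ.continuous.comp_continuousOn hφcont
  have hβ : ContinuousOn (fun t => b (φ t)) (Icc 0 T) := hb.continuous.comp_continuousOn hφcont
  have hAinv : ContinuousOn (fun t => Ring.inverse (σ (φ t))) (Icc 0 T) := fun t ht => by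
    obtain ⟨u, hu⟩ := hinv (φ t)
    have hc := NormedRing.inverse_continuousAt u
    rw [hu] at hc
    exact ContinuousAt.comp_continuousWithinAt (f := fun t => σ (φ t)) hc (hA t ht)
  have hcontrol {φ' : ℝ → EuclideanSpace ℝ (Fin d)}
      (h : MemLp φ' 2 (volume.restrict (Icc 0 T))) :
      MemLp (fun t => Ring.inverse (σ (φ t)) (φ' t - b (φ t))) 2 (volume.restrict (Icc 0 T)) :=
    (h.sub hβ.memLp_Icc).continuousOn_clm_apply hAinv
  refine ⟨⟨?_, ?_⟩, ?_⟩
  · rintro ⟨f, hf1, hf2, hf⟩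
    have hAf := (integrableOn_and_integrableOn_sq_iff_memLp.1
      ⟨hf1, hf2⟩).continuousOn_clm_apply hA
    have hsum := integrableOn_and_integrableOn_sq_iff_memLp.2 (hβ.memLp_Icc.add hAf)
    refine ⟨_, hsum.1, hsum.2, fun t ht => ?_⟩
    rw [hf t ht, add_assoc, ← integral_add_of_integrableOn_Icc hβ.integrableOn_Icc
      (hAf.integrable one_le_two) ht]
    rfl
  · rintro ⟨φ', h1, h2, hφ'⟩
    have hL2 := integrableOn_and_integrableOn_sq_iff_memLp.1 ⟨h1, h2⟩
    have hg := hcontrol hL2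
    have hg' := integrableOn_and_integrableOn_sq_iff_memLp.2 hg
    exact ⟨_, hg'.1, hg'.2, (control_iff_ae_eq hT.le hA (fun t => hinv (φ t)) hβ hL2 hg hφ').2
      (Filter.EventuallyEq.refl _ _)⟩
  · intro φ' h1 h2 hφ'
    have hL2 := integrableOn_and_integrableOn_sq_iff_memLp.1 ⟨h1, h2⟩
    have hg := hcontrol hL2
    have hg' := integrableOn_and_integrableOn_sq_iff_memLp.2 hg
    refine (congrArg sInf ?_).trans (csInf_singleton _)
    ext r
    rw [mem_singleton_iff]
    constructor
    · rintro ⟨f, hf1, hf2, hf, rfl⟩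
      have hfg := (control_iff_ae_eq hT.le hA (fun t => hinv (φ t)) hβ hL2
        (integrableOn_and_integrableOn_sq_iff_memLp.1 ⟨hf1, hf2⟩) hφ').1 hf
      exact congrArg (1 / 2 * ·) (intervalIntegral_congr_of_ae_eq_restrict_Icc
        (hfg.fun_comp fun x => ‖x‖ ^ 2) (right_mem_Icc.2 hT.le))
    · rintro rfl
      exact ⟨_, hg'.1, hg'.2, (control_iff_ae_eq hT.le hA (fun t => hinv (φ t)) hβ hL2 hg hφ').2
        (Filter.EventuallyEq.refl _ _), rfl⟩
end
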